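/- Let A be a simple unital C*-algebra satisfying the following property: for every finite subset F ⊆ A and all ε₁ > 0, ε₂ > 0 there exists a C*-subalgebra C of A containing the unit of A such that F ⊆_{ε₁} C and such that for all positive elements x, y ∈ C with d_τ(x) + ε₂ < d_τ(y) for every tracial state τ of C, one has x ≾ y in C. Then for any positive elements a, b ∈ A and any n ∈ ℕ, if in the C*-algebra M_{n+1}(A) of (n+1)×(n+1) matrices over A the diagonal matrix with n+1 copies of a on the diagonal is Cuntz subequivalent to the diagonal matrix with n copies of b and one 0 on the diagonal, then a ≾ b in A. -/

import Mathlib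

open Filter Topology
open scoped ComplexOrder

/-- Cuntz subequivalence in a topological ring (in particular in a C*-algebra, or in a
matrix algebra over one, where convergence is norm convergence): `a ≾ b` iff there are
sequences `(x_n)`, `(y_n)` with `x_n * b * y_n → a`. -/
def CuntzLE {R : Type*} [Mul R] [TopologicalSpace R] (a b : R) : Prop :=
  ∃ x y : ℕ → R, Tendsto (fun n => x n * b * y n) atTop (𝓝 a)

/-- Cuntz subequivalence witnessed inside a subset `C`. -/
def CuntzLEIn {R : Type*} [Mul R] [TopologicalSpace R] (C : Set R) (a b : R) : Prop :=
  ∃ x y : ℕ → R, (∀ n, x n ∈ C) ∧ (∀ n, y n ∈ C) ∧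
    Tendsto (fun n => x n * b * y n) atTop (𝓝 a)

/-- A tracial state on a unital C*-subalgebra `C` of `A`, encoded by its values:
a function `τ` which is linear, positive and tracial on `C` and sends `1` to `1`. -/
def IsTracialStateOn {A : Type*} [CStarAlgebra A] [PartialOrder A] [StarOrderedRing A]
    (C : Set A) (τ : A → ℂ) : Prop :=
  (∀ x ∈ C, ∀ y ∈ C, τ (x + y) = τ x + τ y) ∧
  (∀ (c : ℂ), ∀ x ∈ C, τ (c • x) = c * τ x) ∧
  (∀ x ∈ C, 0 ≤ x → 0 ≤ τ x) ∧
  τ 1 = 1 ∧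
  (∀ x ∈ C, ∀ y ∈ C, τ (x * y) = τ (y * x))

/-- The dimension function `d_τ(x) := sup_{ε>0} τ(f_ε(x))`, where `f_ε(t) = min(t/ε, 1)`
is applied to `x` via the continuous functional calculus (for `x` in a closed unital
C*-subalgebra `C`, this agrees with the functional calculus computed in `C`). -/
noncomputable def dimFn {A : Type*} [CStarAlgebra A] [PartialOrder A] [StarOrderedRing A]
    (τ : A → ℂ) (x : A) : ℝ :=
  ⨆ ε : Set.Ioi (0 : ℝ), (τ (cfc (fun t : ℝ => min (t / (ε : ℝ)) 1) x)).re

lemma aux_smul_one_unit {B : Type*} [CStarAlgebra B] [PartialOrder B] [StarOrderedRing B]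
    {p : B} (hp : 0 ≤ p) {η : ℝ} (hη : 0 < η) : IsUnit (p + η • (1:B)) := by
  have h1 : IsStrictlyPositive (η • (1:B)) := by
    have : IsStrictlyPositive (1:B) := by simp
    exact this.smul hη
  exact (h1.nonneg_add hp).isUnit

lemma aux_trace_resolvent {B : Type*} [CStarAlgebra B] [PartialOrder B] [StarOrderedRing B]
    (T : B →ₗ[ℝ] ℝ) (hpos : ∀ x, 0 ≤ x → 0 ≤ T x) (htr : ∀ x y, T (x * y) = T (y * x))
    (H X S Y : B) (hH : IsSelfAdjoint H) (hS : IsSelfAdjoint S) (h : H = X * S * Y) :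
    ∃ N : ℝ, 0 < N ∧ ∀ η : ℝ, 0 < η → ∀ U V : Bˣ, (U : B) = H * H + η • (1:B) →
      (V : B) = N • (S * S) + η • (1:B) → T ↑V⁻¹ ≤ T ↑U⁻¹ := by
  have mono : ∀ x y, x ≤ y → T x ≤ T y := fun x y hxy => by
    have := hpos (y - x) (sub_nonneg.2 hxy)
    rw [map_sub] at this; linarith
  set M : ℝ := ‖X‖ ^ 2 + 1 with hM
  set K : ℝ := ‖Y‖ ^ 2 + 1 with hK
  have hM0 : 0 < M := by positivity
  have hK0 : 0 < K := by positivity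
  have hX : star X * X ≤ M • (1:B) := by
    refine CStarAlgebra.star_mul_le_algebraMap_norm_sq.trans ?_
    rw [Algebra.algebraMap_eq_smul_one]
    exact smul_le_smul_of_nonneg_right (by simp [hM]) zero_le_one
  have hY : Y * star Y ≤ K • (1:B) := by
    refine CStarAlgebra.mul_star_le_algebraMap_norm_sq.trans ?_
    rw [Algebra.algebraMap_eq_smul_one]
    exact smul_le_smul_of_nonneg_right (by simp [hK]) zero_le_one
  set W : B := (√M) • (S * Y) with hW
  have sM : √M * √M = M := Real.mul_self_sqrt hM0.le
  have hHW : H * H ≤ star W * W := by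
    have e1 : H * H = star (S * Y) * (star X * X) * (S * Y) := by
      nth_rewrite 1 [← hH.star_eq]
      rw [h]; simp only [star_mul, mul_assoc]
    have e2 : star W * W = star (S * Y) * (M • (1:B)) * (S * Y) := by
      rw [hW, star_smul, smul_mul_smul_comm]; simp [sM]
    rw [e1, e2]
    exact star_left_conjugate_le_conjugate hX _
  have hWS : W * star W ≤ (M * K) • (S * S) := by
    have e1 : W * star W = M • (star S * (Y * star Y) * S) := by
      rw [hW, star_smul, smul_mul_smul_comm, star_trivial, sM]
      congr 1
      nth_rewrite 1 [← hS.star_eq]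
      rw [star_mul, hS.star_eq]; simp only [mul_assoc]
    have e2 : (M * K) • (S * S) = M • (star S * (K • (1:B)) * S) := by
      rw [hS.star_eq]; simp [mul_smul]
    rw [e1, e2]
    exact smul_le_smul_of_nonneg_left (star_left_conjugate_le_conjugate hY _) hM0.le
  refine ⟨M * K, by positivity, fun η hη U V hU hV => ?_⟩
  obtain ⟨P, hP⟩ := aux_smul_one_unit (star_mul_self_nonneg W) hη
  obtain ⟨Q, hQ⟩ := aux_smul_one_unit (mul_star_self_nonneg W) hη
  have one0 : (0:B) ≤ η • (1:B) := smul_nonneg hη.le zero_le_one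
  have i1 : (↑P⁻¹ : B) ≤ ↑U⁻¹ := by
    apply CStarAlgebra.inv_le_inv
    · rw [hU]; refine add_nonneg ?_ one0
      nth_rewrite 1 [← hH.star_eq]; exact star_mul_self_nonneg H
    · rw [hU, hP]; gcongr
  have i2 : (↑V⁻¹ : B) ≤ ↑Q⁻¹ := by
    apply CStarAlgebra.inv_le_inv
    · rw [hQ]; exact add_nonneg (mul_star_self_nonneg W) one0
    · rw [hV, hQ]; gcongr
  have e : (↑Q⁻¹ : B) * W = W * ↑P⁻¹ := by
    have : W * (P:B) = Q * W := by
      rw [hP, hQ]; simp [mul_add, add_mul, mul_assoc]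
    calc (↑Q⁻¹ : B) * W = ↑Q⁻¹ * (W * P) * ↑P⁻¹ := by simp [mul_assoc]
      _ = _ := by rw [this]; simp
  have eP : η • (↑P⁻¹ : B) = 1 - star W * W * ↑P⁻¹ := by
    have := P.mul_inv
    nth_rewrite 1 [hP] at this
    rw [add_mul, smul_mul_assoc, one_mul] at this
    rw [← this]; abel
  have eQ : η • (↑Q⁻¹ : B) = 1 - ↑Q⁻¹ * (W * star W) := by
    have := Q.inv_mul
    nth_rewrite 1 [hQ] at this
    rw [mul_add, mul_smul_comm, mul_one] at this
    rw [← this]; abel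
  have eT : T ↑P⁻¹ = T ↑Q⁻¹ := by
    have : η * T ↑P⁻¹ = η * T ↑Q⁻¹ := by
      rw [← smul_eq_mul, ← smul_eq_mul, ← map_smul, ← map_smul, eP, eQ, map_sub, map_sub,
        mul_assoc, htr, mul_assoc, ← mul_assoc (↑Q⁻¹ : B), e, mul_assoc]
    exact mul_left_cancel₀ hη.ne' this
  calc T ↑V⁻¹ ≤ T ↑Q⁻¹ := mono _ _ i2
    _ = T ↑P⁻¹ := eT.symm
    _ ≤ _ := mono _ _ i1

lemma aux_nonneg_exists {B : Type*} [CStarAlgebra B] [PartialOrder B] [StarOrderedRing B]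
    {x : B} (hx : 0 ≤ x) : ∃ y : B, x = star y * y :=
  CStarAlgebra.nonneg_iff_eq_star_mul_self.1 hx

lemma aux_cfc_inv {C : Type*} [CStarAlgebra C] [PartialOrder C] [StarOrderedRing C]
    {N η : ℝ} (hN : 0 < N) (hη : 0 < η) (s : C) (hs : 0 ≤ s) :
    cfc (fun t : ℝ => (N * (t * t) + η)⁻¹) s * (N • (s * s) + η • (1:C)) = 1 ∧
    (N • (s * s) + η • (1:C)) * cfc (fun t : ℝ => (N * (t * t) + η)⁻¹) s = 1 := by
  have hsa : IsSelfAdjoint s := hs.isSelfAdjoint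
  have hpos : ∀ t : ℝ, N * (t * t) + η ≠ 0 := fun t => by
    have := mul_self_nonneg t; positivity
  have hc : Continuous (fun t : ℝ => (N * (t * t) + η)⁻¹) :=
    Continuous.inv₀ (by fun_prop) hpos
  have e : N • (s * s) + η • (1:C) = cfc (fun t : ℝ => N * (t * t) + η) s := by
    rw [cfc_add_const η (fun t : ℝ => N * (t * t)) s, cfc_const_mul N (fun t : ℝ => t * t) s,
      cfc_mul (fun t : ℝ => t) (fun t : ℝ => t) s, cfc_id' ℝ s, Algebra.algebraMap_eq_smul_one]
  rw [e, ← cfc_mul _ _ s hc.continuousOn, ← cfc_mul _ _ s (by fun_prop) hc.continuousOn]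
  constructor
  · rw [← cfc_one ℝ s]; congr 1; ext t; simp [hpos]
  · rw [← cfc_one ℝ s]; congr 1; ext t; simp [hpos]

lemma aux_matrix {C : Type*} [CStarAlgebra C] [PartialOrder C] [StarOrderedRing C]
    (T : C →ₗ[ℝ] ℝ) (hpos : ∀ x, 0 ≤ x → 0 ≤ T x) (htr : ∀ x y, T (x * y) = T (y * x))
    {ι : Type*} [Fintype ι] [DecidableEq ι] (h s : ι → C) (h0 : ∀ i, 0 ≤ h i)
    (s0 : ∀ i, 0 ≤ s i) (X Y : Matrix ι ι C)
    (hXY : Matrix.diagonal h = X * Matrix.diagonal s * Y) :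
    ∃ N : ℝ, 0 < N ∧ ∀ η : ℝ, 0 < η →
      ∑ i, T (cfc (fun t : ℝ => (N * (t * t) + η)⁻¹) (s i)) ≤
      ∑ i, T (cfc (fun t : ℝ => (1 * (t * t) + η)⁻¹) (h i)) := by
  let D : (ι → C) → CStarMatrix ι ι C := fun d => CStarMatrix.ofMatrix (Matrix.diagonal d)
  have Dsa : ∀ d : ι → C, (∀ i, 0 ≤ d i) → IsSelfAdjoint (D d) := by
    intro d hd
    rw [IsSelfAdjoint, CStarMatrix.star_eq_conjTranspose]
    have : (Matrix.diagonal d).conjTranspose = Matrix.diagonal d := by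
      rw [Matrix.diagonal_conjTranspose]; congr 1; ext i; exact (hd i).isSelfAdjoint
    exact this
  have Dmul : ∀ d e : ι → C, D d * D e = D (fun i => d i * e i) := by
    intro d e
    exact Matrix.diagonal_mul_diagonal d e
  have Dadd : ∀ d e : ι → C, D d + D e = D (fun i => d i + e i) := by
    intro d e
    exact Matrix.diagonal_add d e
  have Dsmul : ∀ (r : ℝ) (d : ι → C), r • D d = D (fun i => r • d i) := by
    intro r d
    exact (Matrix.diagonal_smul r d).symm
  have Done : D (fun _ => 1) = 1 := Matrix.diagonal_one
  let Tr : CStarMatrix ι ι C →ₗ[ℝ] ℝ :=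
    { toFun := fun M => ∑ i, T (M i i)
      map_add' := fun M M' => by simp [Finset.sum_add_distrib]
      map_smul' := fun r M => by simp [Finset.mul_sum] }
  have TrD : ∀ d, Tr (D d) = ∑ i, T (d i) := fun d => by
    simp [Tr, D]
  have Trpos : ∀ x, 0 ≤ x → 0 ≤ Tr x := by
    intro x hx
    obtain ⟨y, rfl⟩ := aux_nonneg_exists (B := CStarMatrix ι ι C) hx
    refine Finset.sum_nonneg fun i _ => hpos _ ?_
    rw [CStarMatrix.mul_apply]
    refine Finset.sum_nonneg fun j _ => ?_
    rw [CStarMatrix.star_apply]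
    exact star_mul_self_nonneg _
  have Trtr : ∀ x y, Tr (x * y) = Tr (y * x) := by
    intro x y
    change ∑ i, T ((x * y) i i) = ∑ i, T ((y * x) i i)
    simp only [CStarMatrix.mul_apply, map_sum]
    rw [Finset.sum_comm]
    simp only [htr]
  obtain ⟨N, hN, key⟩ := aux_trace_resolvent Tr Trpos Trtr (D h) (CStarMatrix.ofMatrix X) (D s)
    (CStarMatrix.ofMatrix Y) (Dsa h h0) (Dsa s s0) hXY
  refine ⟨N, hN, fun η hη => ?_⟩
  let U : (CStarMatrix ι ι C)ˣ :=
    ⟨D (fun i => (1:ℝ) • (h i * h i) + η • (1:C)),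
      D (fun i => cfc (fun t : ℝ => (1 * (t * t) + η)⁻¹) (h i)), by
        rw [Dmul, ← Done]; congr 1; ext i; exact (aux_cfc_inv one_pos hη _ (h0 i)).2, by
        rw [Dmul, ← Done]; congr 1; ext i; exact (aux_cfc_inv one_pos hη _ (h0 i)).1⟩
  let V : (CStarMatrix ι ι C)ˣ :=
    ⟨D (fun i => N • (s i * s i) + η • (1:C)),
      D (fun i => cfc (fun t : ℝ => (N * (t * t) + η)⁻¹) (s i)), by
        rw [Dmul, ← Done]; congr 1; ext i; exact (aux_cfc_inv hN hη _ (s0 i)).2, by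
        rw [Dmul, ← Done]; congr 1; ext i; exact (aux_cfc_inv hN hη _ (s0 i)).1⟩
  have eU : (U : CStarMatrix ι ι C) = D h * D h + η • (1 : CStarMatrix ι ι C) := by
    rw [Dmul, ← Done, Dsmul, Dadd]; simp [U]
  have eV : (V : CStarMatrix ι ι C) = N • (D s * D s) + η • (1 : CStarMatrix ι ι C) := by
    rw [Dmul, ← Done, Dsmul, Dsmul, Dadd]
  have := key η hη U V eU eV
  rw [← TrD, ← TrD]
  exact this

/-- real version of the dimension function -/
noncomputable def auxDim {C : Type*} [CStarAlgebra C] [PartialOrder C] [StarOrderedRing C]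
    (T : C →ₗ[ℝ] ℝ) (x : C) : ℝ :=
  ⨆ ε : Set.Ioi (0 : ℝ), T (cfc (fun t : ℝ => min (t / (ε : ℝ)) 1) x)

lemma aux_le_auxDim {C : Type*} [CStarAlgebra C] [PartialOrder C] [StarOrderedRing C]
    (T : C →ₗ[ℝ] ℝ) (hpos : ∀ x, 0 ≤ x → 0 ≤ T x) (x : C) {ε : ℝ} (hε : 0 < ε) :
    T (cfc (fun t : ℝ => min (t / ε) 1) x) ≤ auxDim T x := by
  refine le_ciSup (f := fun ε : Set.Ioi (0 : ℝ) => T (cfc (fun t : ℝ => min (t / (ε : ℝ)) 1) x))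
    ⟨T 1, ?_⟩ (⟨ε, hε⟩ : Set.Ioi (0 : ℝ))
  rintro _ ⟨δ, rfl⟩
  have : cfc (fun t : ℝ => min (t / (δ : ℝ)) 1) x ≤ 1 := cfc_le_one _ _ fun t _ => min_le_right _ _
  have := hpos _ (sub_nonneg.2 this)
  rw [map_sub] at this
  simp only; linarith

lemma aux_dim_le {C : Type*} [CStarAlgebra C] [PartialOrder C] [StarOrderedRing C]
    (T : C →ₗ[ℝ] ℝ) (hpos : ∀ x, 0 ≤ x → 0 ≤ T x) (htr : ∀ x y, T (x * y) = T (y * x))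
    {ι : Type*} [Fintype ι] [DecidableEq ι] (h s : ι → C) (h0 : ∀ i, 0 ≤ h i)
    (h1 : ∀ i, h i ≤ 1)
    (s0 : ∀ i, 0 ≤ s i) (X Y : Matrix ι ι C)
    (hXY : Matrix.diagonal h = X * Matrix.diagonal s * Y) :
    ∑ i, T (h i) ≤ ∑ i, auxDim T (s i) := by
  have mono : ∀ x y, x ≤ y → T x ≤ T y := fun x y hxy => by
    have := hpos (y - x) (sub_nonneg.2 hxy)
    rw [map_sub] at this; linarith
  obtain ⟨N, hN, key⟩ := aux_matrix T hpos htr h s h0 s0 X Y hXY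
  have main : ∀ θ : ℝ, 0 < θ → ∑ i, T (h i) ≤ ∑ i, auxDim T (s i) + θ * ∑ _i : ι, T 1 := by
    intro θ hθ
    have hη : 0 < θ * θ := by positivity
    have k := key (θ * θ) hη
    have hne : ∀ (N : ℝ), 0 < N → ∀ t : ℝ, 0 < N * (t * t) + θ * θ := fun N hN t => by
      have := mul_self_nonneg t; positivity
    have hc : ∀ (N : ℝ), 0 < N → Continuous (fun t : ℝ => (N * (t * t) + θ * θ)⁻¹) := fun N hN =>
      Continuous.inv₀ (by fun_prop) (fun t => (hne N hN t).ne')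
    have hh : ∀ i, T (h i) ≤ T 1 - (θ * θ) *
        T (cfc (fun t : ℝ => (1 * (t * t) + θ * θ)⁻¹) (h i)) + θ * T 1 := by
      intro i
      have hcc := hc 1 one_pos
      have hc1 : Continuous (fun t : ℝ => θ * θ * (1 * (t * t) + θ * θ)⁻¹) :=
        (continuous_const (y := θ * θ)).mul hcc
      have hc2 : Continuous (fun t : ℝ => 1 - θ * θ * (1 * (t * t) + θ * θ)⁻¹) :=
        (continuous_const (y := (1:ℝ))).sub hc1
      have hsa : IsSelfAdjoint (h i) := (h0 i).isSelfAdjoint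
      have : h i ≤ 1 - (θ * θ) • cfc (fun t : ℝ => (1 * (t * t) + θ * θ)⁻¹) (h i) + θ • (1:C) := by
        have e : 1 - (θ * θ) • cfc (fun t : ℝ => (1 * (t * t) + θ * θ)⁻¹) (h i) + θ • (1:C) =
            cfc (fun t : ℝ => 1 - (θ * θ) * (1 * (t * t) + θ * θ)⁻¹ + θ) (h i) := by
          rw [cfc_add_const θ _ (h i) hc2.continuousOn,
            cfc_sub (fun _ => (1:ℝ)) _ (h i) (by fun_prop) hc1.continuousOn,
            cfc_const_mul _ _ (h i) hcc.continuousOn, Algebra.algebraMap_eq_smul_one,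
            cfc_const_one ℝ (h i)]
        rw [e]
        conv_lhs => rw [← cfc_id' ℝ (h i)]
        refine cfc_mono (fun t ht => ?_) (by fun_prop)
          (hc2.add continuous_const).continuousOn
        have t0 : 0 ≤ t := spectrum_nonneg_of_nonneg (h0 i) ht
        have t1 : t ≤ 1 := (CFC.le_one_iff (R := ℝ) (h i)).1 (h1 i) t ht
        have q := hne 1 one_pos t
        have : 1 - (θ * θ) * (1 * (t * t) + θ * θ)⁻¹ + θ - t =
          ((t * t) * (1 - t) + θ * (t * t - t * θ + θ * θ)) / (1 * (t * t) + θ * θ) := by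
          field_simp; ring
        have h2 : 0 ≤ 1 - (θ * θ) * (1 * (t * t) + θ * θ)⁻¹ + θ - t := by
          rw [this]
          apply div_nonneg _ q.le
          have a1 : 0 ≤ (t * t) * (1 - t) := mul_nonneg (by positivity) (by linarith)
          have a2 : 0 ≤ t * t - t * θ + θ * θ := by nlinarith [sq_nonneg (t - θ)]
          have := mul_nonneg hθ.le a2
          linarith
        linarith
      have := mono _ _ this
      simpa using this
    set ε := θ / (N + 1) with hε
    have hε0 : 0 < ε := by positivity
    have hεN : N * (ε * ε) ≤ θ * θ := by
      have : θ = ε * (N + 1) := by rw [hε]; field_simp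
      have : θ * θ = ε * ε * ((N + 1) * (N + 1)) := by rw [this]; ring
      rw [this]
      have : 0 < ε * ε := by positivity
      nlinarith
    have hs : ∀ i, T 1 - (θ * θ) *
        T (cfc (fun t : ℝ => (N * (t * t) + θ * θ)⁻¹) (s i)) ≤ auxDim T (s i) := by
      intro i
      refine le_trans ?_ (aux_le_auxDim T hpos (s i) hε0)
      have hcc := hc N hN
      have hc1 : Continuous (fun t : ℝ => θ * θ * (N * (t * t) + θ * θ)⁻¹) :=
        (continuous_const (y := θ * θ)).mul hcc
      have hc2 : Continuous (fun t : ℝ => 1 - θ * θ * (N * (t * t) + θ * θ)⁻¹) :=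
        (continuous_const (y := (1:ℝ))).sub hc1
      have hsa : IsSelfAdjoint (s i) := (s0 i).isSelfAdjoint
      have e : 1 - (θ * θ) • cfc (fun t : ℝ => (N * (t * t) + θ * θ)⁻¹) (s i) =
          cfc (fun t : ℝ => 1 - (θ * θ) * (N * (t * t) + θ * θ)⁻¹) (s i) := by
        rw [cfc_sub (fun _ => (1:ℝ)) _ (s i) (by fun_prop) hc1.continuousOn,
          cfc_const_mul _ _ (s i) hcc.continuousOn, cfc_const_one ℝ (s i)]
      have : 1 - (θ * θ) • cfc (fun t : ℝ => (N * (t * t) + θ * θ)⁻¹) (s i) ≤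
          cfc (fun t : ℝ => min (t / ε) 1) (s i) := by
        rw [e]
        refine cfc_mono (fun t ht => ?_) hc2.continuousOn (by fun_prop)
        have t0 : 0 ≤ t := spectrum_nonneg_of_nonneg (s0 i) ht
        have q := hne N hN t
        apply le_min
        · rcases le_total t ε with hte | hte
          · have : 1 - (θ * θ) * (N * (t * t) + θ * θ)⁻¹ = (N * (t * t)) / (N * (t * t) + θ * θ) := by
              field_simp; ring
            rw [this, div_le_div_iff₀ q hε0]
            have b1 : N * (t * t) * ε ≤ N * (ε * ε) * t := by
              have : 0 ≤ N * t * ε * (ε - t) :=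
                mul_nonneg (by positivity) (by linarith)
              nlinarith
            have b2 : N * (ε * ε) * t ≤ (θ * θ) * t := mul_le_mul_of_nonneg_right hεN t0
            have b3 : 0 ≤ t * (N * (t * t)) := by positivity
            linarith
          · have : 1 ≤ t / ε := (one_le_div hε0).2 hte
            have : 0 ≤ (θ * θ) * (N * (t * t) + θ * θ)⁻¹ := by positivity
            linarith
        · have : 0 ≤ (θ * θ) * (N * (t * t) + θ * θ)⁻¹ := by positivity
          linarith
      have := mono _ _ this
      simpa using this
    calc ∑ i, T (h i) ≤ ∑ i, (T 1 - (θ * θ) *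
        T (cfc (fun t : ℝ => (1 * (t * t) + θ * θ)⁻¹) (h i)) + θ * T 1) :=
          Finset.sum_le_sum fun i _ => hh i
      _ = ∑ _i : ι, T 1 - (θ * θ) * ∑ i, T (cfc (fun t : ℝ => (1 * (t * t) + θ * θ)⁻¹) (h i))
          + θ * ∑ _i : ι, T 1 := by
          rw [Finset.sum_add_distrib, Finset.sum_sub_distrib, Finset.mul_sum, Finset.mul_sum]
      _ ≤ ∑ _i : ι, T 1 - (θ * θ) * ∑ i, T (cfc (fun t : ℝ => (N * (t * t) + θ * θ)⁻¹) (s i))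
          + θ * ∑ _i : ι, T 1 := by gcongr
      _ = ∑ i, (T 1 - (θ * θ) * T (cfc (fun t : ℝ => (N * (t * t) + θ * θ)⁻¹) (s i)))
          + θ * ∑ _i : ι, T 1 := by
          rw [Finset.sum_sub_distrib, Finset.mul_sum]
      _ ≤ _ := by
          gcongr with i _
          exact hs i
  have hlim : Tendsto (fun θ : ℝ => ∑ i, auxDim T (s i) + θ * ∑ _i : ι, T 1) (𝓝[>] 0)
      (𝓝 (∑ i, auxDim T (s i))) := by
    have : Continuous (fun θ : ℝ => ∑ i, auxDim T (s i) + θ * ∑ _i : ι, T 1) := by fun_prop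
    have := (this.tendsto 0).mono_left (nhdsWithin_le_nhds (s := Set.Ioi 0))
    simpa using this
  exact ge_of_tendsto hlim (by filter_upwards [self_mem_nhdsWithin] with θ hθ using main θ hθ)

lemma aux_neumann {R : Type*} [NormedRing R] [CompleteSpace R] (g l r m : R)
    (hg : g * l * r = g) (hn : ‖l * (r - m)‖ < 1) : ∃ Y, g = g * l * m * Y := by
  let u := Units.oneSub (l * (r - m)) hn
  refine ⟨↑u⁻¹, ?_⟩
  have : g * l * m = g * u := by
    simp only [u, Units.val_oneSub, mul_sub, mul_one, ← mul_assoc, hg]; abel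
  rw [this]; simp [mul_assoc]

lemma aux_neumann_matrix {C : Type*} [CStarAlgebra C] {ι : Type*} [Fintype ι] [DecidableEq ι]
    (g l r m : Matrix ι ι C)
    (hg : g * l * r = g) (c : ℝ) (hc : ∀ i j, ‖(l * (r - m)) i j‖ ≤ c) (hc0 : 0 ≤ c)
    (hc1 : Fintype.card ι * c < 1) : ∃ Y, g = g * l * m * Y := by
  let _ : NormedRing (Matrix ι ι C) := Matrix.linftyOpNormedRing
  have : @CompleteSpace (Matrix ι ι C) PseudoMetricSpace.toUniformSpace :=
    inferInstanceAs (CompleteSpace (ι → ι → C))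
  refine aux_neumann g l r m hg (lt_of_le_of_lt ?_ hc1)
  have key : ∀ M : Matrix ι ι C, (∀ i j, ‖M i j‖ ≤ c) →
      ((Finset.univ.sup fun i : ι => ∑ j, ‖M i j‖₊ : NNReal) : ℝ) ≤ Fintype.card ι * c := by
    intro M hM
    lift c to NNReal using hc0
    have : (Finset.univ.sup fun i : ι => ∑ j, ‖M i j‖₊) ≤ Fintype.card ι * c := by
      refine Finset.sup_le fun i _ => ?_
      have hM1 : ∀ j, ‖M i j‖₊ ≤ c := fun j => NNReal.coe_le_coe.1 (hM i j)
      refine (Finset.sum_le_sum fun j _ => hM1 j).trans ?_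
      simp
    exact_mod_cast this
  exact (Matrix.linfty_opNorm_def _).trans_le (key _ hc)

/-- the cut-down relation -/
lemma aux_cut {A : Type*} [CStarAlgebra A] [PartialOrder A] [StarOrderedRing A]
    (r : A) (hr : IsSelfAdjoint r) {δ : ℝ} (hδ : 0 < δ) (f : ℝ → ℝ) (hf : Continuous f)
    (hf0 : ∀ t, t ≤ δ → f t = 0) :
    cfc f r * cfc (fun t : ℝ => (max t δ)⁻¹) r * r = cfc f r ∧
      ‖cfc (fun t : ℝ => (max t δ)⁻¹) r‖ ≤ δ⁻¹ := by
  have hp : ∀ t : ℝ, 0 < max t δ := fun t => lt_max_of_lt_right hδ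
  have hc : Continuous (fun t : ℝ => (max t δ)⁻¹) :=
    Continuous.inv₀ (by fun_prop) (fun t => (hp t).ne')
  constructor
  · conv_lhs => rw [← cfc_mul _ _ r hf.continuousOn hc.continuousOn]
    conv_lhs => enter [2]; rw [← cfc_id' ℝ r]
    have hfc : Continuous (fun t : ℝ => f t * (max t δ)⁻¹) := hf.mul hc
    rw [← cfc_mul _ _ r hfc.continuousOn (by fun_prop)]
    congr 1; ext t
    rcases le_total t δ with h | h
    · simp [hf0 t h]
    · rw [max_eq_left h]
      have : t ≠ 0 := (hδ.trans_le h).ne'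
      field_simp
  · refine norm_cfc_le (by positivity) fun t _ => ?_
    rw [Real.norm_of_nonneg (inv_nonneg.2 (hp t).le)]
    exact inv_anti₀ hδ (le_max_right _ _)

lemma aux_gap {C : Type*} [CStarAlgebra C] [PartialOrder C] [StarOrderedRing C]
    (T : C →ₗ[ℝ] ℝ) (hpos : ∀ x, 0 ≤ x → 0 ≤ T x) (htr : ∀ x y, T (x * y) = T (y * x))
    (hone : T 1 = 1) (a y : C) (ha : 0 ≤ a) (hy : 0 ≤ y) {ε : ℝ} (hε : 0 < ε) (n : ℕ)
    (X Y : Matrix (Fin (n + 1)) (Fin (n + 1)) C)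
    (hXY : ∀ i j, ‖(Matrix.diagonal (fun _ : Fin (n + 1) => a) -
      X * Matrix.diagonal (fun i : Fin (n + 1) => if (i : ℕ) < n then y else 0) * Y) i j‖
        ≤ ε / (2 * (n + 1)))
    {κ : Type} [Fintype κ] (z w : κ → C) (hzw : ‖1 - ∑ i, z i * y * w i‖ < 1) :
    auxDim T (cfc (fun t : ℝ => max (t - ε) 0) a) + 1 / (2 * (Fintype.card κ + 1) * (n + 1))
      < auxDim T y := by
  classical
  have asa := ha.isSelfAdjoint
  have d0 : auxDim T (0 : C) = 0 := by
    unfold auxDim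
    simp [cfc_apply_zero]
  have s1 : ∀ η : ℝ, 0 < η → (n + 1) * T (cfc (fun t : ℝ => min (t / η) 1)
      (cfc (fun t : ℝ => max (t - ε) 0) a)) ≤ n * auxDim T y := by
    intro η hη
    have hf : Continuous (fun t : ℝ => min (max (t - ε) 0 / η) 1) := by fun_prop
    have e : cfc (fun t : ℝ => min (t / η) 1) (cfc (fun t : ℝ => max (t - ε) 0) a) =
        cfc (fun t : ℝ => min (max (t - ε) 0 / η) 1) a := by
      rw [← cfc_comp' (fun t : ℝ => min (t / η) 1) (fun t : ℝ => max (t - ε) 0) a]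
    rw [e]
    obtain ⟨c1, c2⟩ := aux_cut a asa hε _ hf (fun t ht => by
      rw [max_eq_right (by linarith)]; simp)
    set G := cfc (fun t : ℝ => min (max (t - ε) 0 / η) 1) a with hG
    set l := cfc (fun t : ℝ => (max t ε)⁻¹) a with hl
    have hG0 : 0 ≤ G := cfc_nonneg fun t _ => le_min (by positivity) zero_le_one
    have hG1 : G ≤ 1 := cfc_le_one _ _ fun t _ => min_le_right _ _
    obtain ⟨Y', hY'⟩ := aux_neumann_matrix (Matrix.diagonal (fun _ : Fin (n + 1) => G))
      (Matrix.diagonal (fun _ : Fin (n + 1) => l)) (Matrix.diagonal (fun _ : Fin (n + 1) => a))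
      (X * Matrix.diagonal (fun i : Fin (n + 1) => if (i : ℕ) < n then y else 0) * Y)
      (by simp [Matrix.diagonal_mul_diagonal, c1]) (1 / (2 * (n + 1)))
      (fun i j => by
        rw [Matrix.diagonal_mul]
        refine (norm_mul_le _ _).trans ((mul_le_mul c2 (hXY i j) (norm_nonneg _)
          (by positivity)).trans (le_of_eq ?_))
        field_simp) (by positivity) (by
          simp only [Fintype.card_fin]; push_cast
          field_simp; norm_num)
    have := aux_dim_le T hpos htr (fun _ : Fin (n + 1) => G)
      (fun i : Fin (n + 1) => if (i : ℕ) < n then y else 0) (fun _ => hG0) (fun _ => hG1)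
      (fun i => by split_ifs; exacts [hy, le_rfl])
      (Matrix.diagonal (fun _ : Fin (n + 1) => G) * Matrix.diagonal (fun _ : Fin (n + 1) => l) * X)
      (Y * Y') (by simpa only [mul_assoc] using hY')
    rw [Fin.sum_univ_castSucc (n := n) (f := fun i : Fin (n+1) => auxDim T _)] at this
    simpa [d0] using this
  have s2 : auxDim T (cfc (fun t : ℝ => max (t - ε) 0) a) ≤ n * auxDim T y / (n + 1) := by
    have : Nonempty (Set.Ioi (0:ℝ)) := ⟨⟨1, Set.mem_Ioi.2 one_pos⟩⟩
    refine ciSup_le fun η => ?_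
    rw [le_div_iff₀ (by positivity), mul_comm]
    exact s1 η η.2
  have s3 : 1 ≤ (Fintype.card κ + 1) * auxDim T y := by
    let u := Units.oneSub _ hzw
    have hu : (u : C) = ∑ i, z i * y * w i := by simp [u]
    have := aux_dim_le T hpos htr (fun i : Option κ => if i = none then (1:C) else 0)
      (fun _ => y) (fun i => by split_ifs; exacts [zero_le_one, le_rfl])
      (fun i => by split_ifs; exacts [le_rfl, zero_le_one])
      (fun _ => hy)
      (Matrix.of fun i j => if i = none then Option.elim j 0 z else 0)
      (Matrix.of fun i j => if j = none then Option.elim i 0 (fun i => w i * ↑u⁻¹) else 0)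
      (by
        ext i j
        rw [Matrix.mul_apply]
        simp only [Matrix.mul_diagonal, Matrix.of_apply, Fintype.sum_option, Option.elim]
        rcases i with _ | i <;> rcases j with _ | j
        · simp [← mul_assoc, ← Finset.sum_mul, ← hu]
        · simp
        · simp
        · simp [Matrix.diagonal_apply])
    simpa [hone] using this
  set D := auxDim T y
  set k : ℝ := (Fintype.card κ : ℝ)
  have hk : 0 ≤ k := Nat.cast_nonneg _
  have hn : (0:ℝ) ≤ n := Nat.cast_nonneg _
  have : n * D / (n + 1) + 1 / (2 * (k + 1) * (n + 1)) < D := by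
    have : D - (n * D / (n + 1) + 1 / (2 * (k + 1) * (n + 1))) =
      (2 * ((k + 1) * D) - 1) / (2 * (k + 1) * (n + 1)) := by field_simp; ring
    have : 0 < D - (n * D / (n + 1) + 1 / (2 * (k + 1) * (n + 1))) := by
      rw [this]; apply div_pos; linarith; positivity
    linarith
  linarith

lemma aux_gapA {A C : Type*} [CStarAlgebra A] [PartialOrder A] [StarOrderedRing A]
    [CStarAlgebra C] [PartialOrder C] [StarOrderedRing C]
    (φ : C →⋆ₐ[ℂ] A) (hφ : Isometry φ) (τ : A → ℂ) (hτ : IsTracialStateOn (Set.range φ) τ)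
    (a y : C) (ha : 0 ≤ a) (hy : 0 ≤ y) {ε : ℝ} (hε : 0 < ε) (n : ℕ)
    (X Y : Fin (n + 1) → Fin (n + 1) → C)
    (hXY : ∀ i j, ‖(Matrix.diagonal (fun _ : Fin (n + 1) => φ a) -
      Matrix.of (fun i j => φ (X i j)) *
        Matrix.diagonal (fun i : Fin (n + 1) => if (i : ℕ) < n then φ y else 0) *
      Matrix.of (fun i j => φ (Y i j))) i j‖ ≤ ε / (2 * (n + 1)))
    {κ : Type} [Fintype κ] (z w : κ → C) (hzw : ‖1 - ∑ i, φ (z i) * φ y * φ (w i)‖ < 1) :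
    dimFn τ (φ (cfc (fun t : ℝ => max (t - ε) 0) a)) +
      1 / (2 * (Fintype.card κ + 1) * (n + 1)) < dimFn τ (φ y) := by
  obtain ⟨t1, t2, t3, t4, t5⟩ := hτ
  have hnorm : ∀ x, ‖φ x‖ = ‖x‖ := fun x => hφ.norm_map_of_map_zero (map_zero φ) x
  let T : C →ₗ[ℝ] ℝ :=
    { toFun := fun x => (τ (φ x)).re
      map_add' := fun x y => by
        rw [map_add, t1 _ ⟨x, rfl⟩ _ ⟨y, rfl⟩, Complex.add_re]
      map_smul' := fun r x => by
        rw [← Complex.coe_smul, map_smul, t2 _ _ ⟨x, rfl⟩]; simp }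
  have hT : ∀ x, T x = (τ (φ x)).re := fun x => rfl
  have hd : ∀ x : C, 0 ≤ x → dimFn τ (φ x) = auxDim T x := by
    intro x hx
    unfold dimFn auxDim
    congr 1; ext δ
    rw [hT]
    have hc : Continuous (fun t : ℝ => min (t / (δ : ℝ)) 1) := by fun_prop
    rw [StarAlgHomClass.map_cfc φ _ x hc.continuousOn hφ.continuous hx.isSelfAdjoint
      (hx.isSelfAdjoint.map φ)]
  rw [hd _ (cfc_nonneg fun t _ => le_max_right _ _), hd _ hy]
  refine aux_gap T ?_ ?_ ?_ a y ha hy hε n (Matrix.of X) (Matrix.of Y) ?_ z w ?_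
  · intro x hx
    obtain ⟨v, rfl⟩ := aux_nonneg_exists hx
    have := t3 (φ (star v * v)) ⟨_, rfl⟩ (by rw [map_mul, map_star]; exact star_mul_self_nonneg _)
    exact (Complex.le_def.1 this).1
  · intro x x'
    rw [hT, hT, map_mul, map_mul, t5 _ ⟨x, rfl⟩ _ ⟨x', rfl⟩]
  · rw [hT, map_one, t4]; simp
  · intro i j
    rw [← hnorm]
    refine le_of_eq_of_le ?_ (hXY i j)
    congr 1
    rw [Matrix.sub_apply, Matrix.sub_apply, map_sub, Matrix.mul_apply, Matrix.mul_apply, map_sum]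
    congr 1
    · simp only [Matrix.diagonal_apply]; split_ifs <;> simp
    · refine Finset.sum_congr rfl fun l _ => ?_
      simp only [Matrix.mul_diagonal, Matrix.of_apply]
      split_ifs <;> simp
  · rw [← hnorm]; simpa using hzw

lemma aux_simple {A : Type*} [CStarAlgebra A]
    (hsimple : ∀ I : TwoSidedIdeal A, IsClosed (I : Set A) → I = ⊥ ∨ I = ⊤)
    (b : A) (hb : b ≠ 0) :
    ∃ (κ : Type) (_ : Fintype κ) (z w : κ → A), ‖1 - ∑ i, z i * b * w i‖ < 1 := by
  let G : AddSubgroup A := AddSubgroup.closure {x | ∃ z w, x = z * b * w}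
  have hGl : ∀ c x, x ∈ G → c * x ∈ G := by
    intro c x hx
    induction hx using AddSubgroup.closure_induction with
    | mem x hx =>
      obtain ⟨z, w, rfl⟩ := hx
      exact AddSubgroup.subset_closure ⟨c * z, w, by simp only [mul_assoc]⟩
    | zero => simp
    | add x y _ _ h1 h2 => rw [mul_add]; exact add_mem h1 h2
    | neg x _ h => rw [mul_neg]; exact neg_mem h
  have hGr : ∀ c x, x ∈ G → x * c ∈ G := by
    intro c x hx
    induction hx using AddSubgroup.closure_induction with
    | mem x hx =>
      obtain ⟨z, w, rfl⟩ := hx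
      exact AddSubgroup.subset_closure ⟨z, w * c, by simp only [mul_assoc]⟩
    | zero => simp
    | add x y _ _ h1 h2 => rw [add_mul]; exact add_mem h1 h2
    | neg x _ h => rw [neg_mul]; exact neg_mem h
  let J : TwoSidedIdeal A := TwoSidedIdeal.mk' (G.topologicalClosure : Set A)
    (zero_mem _) (fun h1 h2 => add_mem h1 h2) (fun h => neg_mem h)
    (fun {x y} h => map_mem_closure (continuous_const_mul x) h (fun g hg => hGl x g hg))
    (fun {x y} h => map_mem_closure (f := fun t => t * y) (continuous_mul_const y) h (fun g hg => hGr y g hg))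
  have hJ : (J : Set A) = (G.topologicalClosure : Set A) := by
    ext x; exact TwoSidedIdeal.mem_mk' _ _ _ _ _ _ x
  have hbG : b ∈ G := AddSubgroup.subset_closure ⟨1, 1, by simp⟩
  have h1 : (1 : A) ∈ closure (G : Set A) := by
    have : J = ⊤ := by
      refine (hsimple J (by rw [hJ]; exact G.isClosed_topologicalClosure)).resolve_left ?_
      intro h
      have : b ∈ (J : Set A) := by rw [hJ]; exact subset_closure hbG
      rw [h] at this
      exact hb (by simpa using this)
    have h : (1:A) ∈ (J : Set A) := by rw [this]; simp
    rw [hJ] at h; exact h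
  obtain ⟨g, hg, hd⟩ := Metric.mem_closure_iff.1 h1 1 one_pos
  rw [dist_eq_norm] at hd
  have : ∀ g ∈ G, ∃ (κ : Type) (_ : Fintype κ) (z w : κ → A), g = ∑ i, z i * b * w i := by
    intro g hg
    induction hg using AddSubgroup.closure_induction with
    | mem x hx =>
      obtain ⟨z, w, rfl⟩ := hx
      exact ⟨Unit, inferInstance, fun _ => z, fun _ => w, by simp⟩
    | zero => exact ⟨Empty, inferInstance, fun _ => 0, fun _ => 0, by simp⟩
    | add x y _ _ h1 h2 =>
      obtain ⟨κ, i1, z, w, rfl⟩ := h1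
      obtain ⟨κ', i2, z', w', rfl⟩ := h2
      exact ⟨κ ⊕ κ', inferInstance, Sum.elim z z', Sum.elim w w', by simp⟩
    | neg x _ h =>
      obtain ⟨κ, i1, z, w, rfl⟩ := h
      exact ⟨κ, i1, fun i => - z i, w, by simp⟩
  obtain ⟨κ, i1, z, w, rfl⟩ := this g hg
  exact ⟨κ, i1, z, w, hd⟩

lemma aux_perturb {A : Type*} [CStarAlgebra A] (a b r₀ : A) (hr : star r₀ * r₀ = a) (n : ℕ)
    (X Y : Fin (n + 1) → Fin (n + 1) → A) {c ε : ℝ} (hε : 0 < ε)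
    (hXY : ∀ i j, ‖(Matrix.diagonal (fun _ : Fin (n + 1) => a) -
      Matrix.of X * Matrix.diagonal (fun i : Fin (n + 1) => if (i : ℕ) < n then b else 0) *
      Matrix.of Y) i j‖ < c)
    {κ : Type} [Fintype κ] (z w : κ → A) (hzw : ‖1 - ∑ i, z i * b * w i‖ < 1) :
    ∃ ρ > 0, ∀ (X' Y' : Fin (n + 1) → Fin (n + 1) → A) (z' w' : κ → A) (y r : A),
      (∀ i j, dist (X' i j) (X i j) < ρ) → (∀ i j, dist (Y' i j) (Y i j) < ρ) →
      (∀ i, dist (z' i) (z i) < ρ) → (∀ i, dist (w' i) (w i) < ρ) →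
      dist y b < ρ → dist r r₀ < ρ →
      (∀ i j, ‖(Matrix.diagonal (fun _ : Fin (n + 1) => star r * r) -
      Matrix.of X' * Matrix.diagonal (fun i : Fin (n + 1) => if (i : ℕ) < n then y else 0) *
      Matrix.of Y') i j‖ < c) ∧ ‖1 - ∑ i, z' i * y * w' i‖ < 1 ∧ ‖star r * r - a‖ < ε := by
  let P := (Fin (n + 1) → Fin (n + 1) → A) × (Fin (n + 1) → Fin (n + 1) → A) ×
    (κ → A) × (κ → A) × A × A
  let p₀ : P := (X, Y, z, w, b, r₀)
  have h1 : ∀ᶠ p : P in 𝓝 p₀, ∀ i j,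
      ‖(Matrix.diagonal (fun _ : Fin (n + 1) => star p.2.2.2.2.2 * p.2.2.2.2.2) -
      Matrix.of p.1 * Matrix.diagonal
        (fun i : Fin (n + 1) => if (i : ℕ) < n then p.2.2.2.2.1 else 0) *
      Matrix.of p.2.1) i j‖ < c := by
    rw [eventually_all]; intro i
    rw [eventually_all]; intro j
    refine ContinuousAt.eventually_lt (Continuous.continuousAt ?_) continuousAt_const ?_
    · refine Continuous.norm (Continuous.matrix_elem ?_ i j)
      refine Continuous.sub (Continuous.matrix_diagonal (by fun_prop)) ?_
      refine Continuous.matrix_mul (Continuous.matrix_mul ?_ ?_) ?_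
      · exact continuous_fst
      · refine Continuous.matrix_diagonal (continuous_pi fun i => ?_)
        split_ifs <;> fun_prop
      · exact continuous_fst.comp continuous_snd
    · simp only [p₀, hr]; exact hXY i j
  have h2 : ∀ᶠ p : P in 𝓝 p₀, ‖1 - ∑ i, p.2.2.1 i * p.2.2.2.2.1 * p.2.2.2.1 i‖ < 1 := by
    refine ContinuousAt.eventually_lt (Continuous.continuousAt ?_) continuousAt_const hzw
    fun_prop
  have h3 : ∀ᶠ p : P in 𝓝 p₀, ‖star p.2.2.2.2.2 * p.2.2.2.2.2 - a‖ < ε := by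
    refine ContinuousAt.eventually_lt (Continuous.continuousAt ?_) continuousAt_const ?_
    · fun_prop
    · simp only [p₀, hr, sub_self, norm_zero]; exact hε
  obtain ⟨ρ, hρ, H⟩ := Metric.eventually_nhds_iff.1 (h1.and (h2.and h3))
  refine ⟨ρ, hρ, fun X' Y' z' w' y r k1 k2 k3 k4 k5 k6 => ?_⟩
  refine H (y := ((X', Y', z', w', y, r) : P)) ?_
  have k1' : dist X' X < ρ := (dist_pi_lt_iff hρ).2 fun i => (dist_pi_lt_iff hρ).2 (k1 i)
  have k2' : dist Y' Y < ρ := (dist_pi_lt_iff hρ).2 fun i => (dist_pi_lt_iff hρ).2 (k2 i)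
  have k3' : dist z' z < ρ := (dist_pi_lt_iff hρ).2 k3
  have k4' : dist w' w < ρ := (dist_pi_lt_iff hρ).2 k4
  exact max_lt k1' (max_lt k2' (max_lt k3' (max_lt k4' (max_lt k5 k6))))

lemma aux_cut_norm {C : Type*} [CStarAlgebra C] [PartialOrder C] [StarOrderedRing C]
    (b : C) (hb : 0 ≤ b) {δ : ℝ} (hδ : 0 < δ) :
    ‖cfc (fun t : ℝ => max (t - δ) 0) b - b‖ ≤ δ := by
  have hsa : IsSelfAdjoint b := hb.isSelfAdjoint
  have : cfc (fun t : ℝ => max (t - δ) 0) b - b = cfc (fun t : ℝ => max (t - δ) 0 - t) b := by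
    rw [cfc_sub _ _ b (by fun_prop) (by fun_prop), cfc_id' ℝ b]
  rw [this]
  refine norm_cfc_le hδ.le fun t ht => ?_
  have h0 : 0 ≤ t := spectrum_nonneg_of_nonneg hb ht
  rw [Real.norm_eq_abs, abs_le]
  rcases le_total (t - δ) 0 with h | h
  · rw [max_eq_right h]; constructor <;> linarith
  · rw [max_eq_left h]; constructor <;> linarith

lemma aux_core {A C : Type*} [CStarAlgebra A] [PartialOrder A] [StarOrderedRing A]
    [CStarAlgebra C] [PartialOrder C] [StarOrderedRing C]
    (φ : C →⋆ₐ[ℂ] A) (hφ : Isometry φ) (n : ℕ) {κ : Type} [Fintype κ]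
    (hcomp : ∀ x y : C, 0 ≤ φ x → 0 ≤ φ y →
      (∀ τ : A → ℂ, IsTracialStateOn (Set.range φ) τ →
        dimFn τ (φ x) + 1 / (2 * (Fintype.card κ + 1) * (n + 1)) < dimFn τ (φ y)) →
      CuntzLEIn (Set.range φ) (φ x) (φ y))
    (a b : A) (r d : C) (X Y : Fin (n + 1) → Fin (n + 1) → C) (z w : κ → C)
    {ε ρ : ℝ} (hε : 0 < ε) (hρ : 0 < ρ)
    (hd : ‖φ (star d * d) - b‖ < ρ / 3)
    (H : ∀ y : A, dist y b < ρ → 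
      (∀ i j, ‖(Matrix.diagonal (fun _ : Fin (n + 1) => star (φ r) * φ r) -
      Matrix.of (fun i j => φ (X i j)) *
        Matrix.diagonal (fun i : Fin (n + 1) => if (i : ℕ) < n then y else 0) *
      Matrix.of (fun i j => φ (Y i j))) i j‖ < ε / (2 * (n + 1))) ∧
      ‖1 - ∑ i, φ (z i) * y * φ (w i)‖ < 1 ∧ ‖star (φ r) * φ r - a‖ < ε) :
    ∃ U V : A, ‖U * b * V - a‖ < 3 * ε := by
  have hnorm : ∀ x, ‖φ x‖ = ‖x‖ := fun x => hφ.norm_map_of_map_zero (map_zero φ) x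
  have hδ : 0 < ρ / 3 := by positivity
  have ha' : 0 ≤ star r * r := star_mul_self_nonneg r
  have hb' : 0 ≤ star d * d := star_mul_self_nonneg d
  have hpos : ∀ x : C, 0 ≤ x → 0 ≤ φ x := by
    intro x hx
    obtain ⟨v, rfl⟩ := aux_nonneg_exists hx
    rw [map_mul, map_star]; exact star_mul_self_nonneg _
  set b' := star d * d
  set y := cfc (fun t : ℝ => max (t - ρ / 3) 0) b' with hy
  set x := cfc (fun t : ℝ => max (t - ε) 0) (star r * r) with hx
  have hy0 : 0 ≤ y := cfc_nonneg fun t _ => le_max_right _ _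
  have hx0 : 0 ≤ x := cfc_nonneg fun t _ => le_max_right _ _
  have hyb : ‖φ y - φ b'‖ ≤ ρ / 3 := by
    rw [← map_sub, hnorm]; exact aux_cut_norm b' hb' hδ
  have hxa : ‖φ x - star (φ r) * φ r‖ ≤ ε := by
    rw [← map_star, ← map_mul, ← map_sub, hnorm]; exact aux_cut_norm _ ha' hε
  have hdist : dist (φ y) b < ρ := by
    rw [dist_eq_norm]
    have := norm_sub_le_norm_sub_add_norm_sub (φ y) (φ b') b
    linarith
  obtain ⟨H1, H2, H3⟩ := H _ hdist
  obtain ⟨u, v, -, -, huv⟩ := hcomp x y (hpos x hx0) (hpos y hy0) fun τ hτ => by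
    refine aux_gapA φ hφ τ hτ _ y ha' hy0 hε n X Y (fun i j => ?_) z w H2
    rw [map_mul, map_star]; exact (H1 i j).le
  obtain ⟨m, hm⟩ := (Metric.tendsto_atTop.1 huv ε hε).imp fun N h => h N le_rfl
  have hsa : IsSelfAdjoint b' := hb'.isSelfAdjoint
  have hcont : Continuous (fun t : ℝ => max (t - ρ / 3) 0) := by fun_prop
  obtain ⟨k1, k2⟩ := aux_cut b' hsa hδ (fun t : ℝ => max (t - ρ / 3) 0) hcont
    (fun t ht => max_eq_right (by linarith))
  obtain ⟨W, hW⟩ := aux_neumann (φ y) (φ (cfc (fun t : ℝ => (max t (ρ / 3))⁻¹) b')) (φ b') b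
    (by rw [← map_mul, ← map_mul, k1]) (by
      refine (norm_mul_le _ _).trans_lt ?_
      rw [hnorm]
      calc _ ≤ (ρ / 3)⁻¹ * ‖φ b' - b‖ := by gcongr
        _ < (ρ / 3)⁻¹ * (ρ / 3) := by gcongr
        _ = 1 := inv_mul_cancel₀ hδ.ne')
  refine ⟨u m * (φ y * φ (cfc (fun t : ℝ => (max t (ρ / 3))⁻¹) b')), W * v m, ?_⟩
  have e : u m * (φ y * φ (cfc (fun t : ℝ => (max t (ρ / 3))⁻¹) b')) * b * (W * v m)
      = u m * φ y * v m := by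
    conv_rhs => rw [hW]
    simp only [mul_assoc]
  rw [e]
  rw [dist_eq_norm] at hm
  have t1 := norm_sub_le_norm_sub_add_norm_sub (u m * φ y * v m) (φ x) a
  have t2 := norm_sub_le_norm_sub_add_norm_sub (φ x) (star (φ r) * φ r) a
  linarith

/-- let `A` be a simple unital C*-algebra which is locally approximated by
unital C*-subalgebras `C` in which comparison holds up to an arbitrarily small tracial
gap `ε₂`. If `diag(a, …, a)` (`n+1` copies) is Cuntz subequivalent to `diag(b, …, b, 0)`
(`n` copies of `b`) in `M_{n+1}(A)`, then `a ≾ b` in `A`. -/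
theorem cuntzLE_of_almost_unperforated {A : Type*} [CStarAlgebra A]
    [PartialOrder A] [StarOrderedRing A]
    (hsimple : ∀ I : TwoSidedIdeal A, IsClosed (I : Set A) → I = ⊥ ∨ I = ⊤)
    (happrox : ∀ (F : Finset A) (ε₁ ε₂ : ℝ), 0 < ε₁ → 0 < ε₂ →
      ∃ C : StarSubalgebra ℂ A, IsClosed (C : Set A) ∧
        (∀ f ∈ F, ∃ c ∈ C, ‖f - c‖ ≤ ε₁) ∧
        (∀ x ∈ C, ∀ y ∈ C, 0 ≤ x → 0 ≤ y →
          (∀ τ : A → ℂ, IsTracialStateOn (C : Set A) τ → dimFn τ x + ε₂ < dimFn τ y) →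
          CuntzLEIn (C : Set A) x y))
    (a b : A) (ha : 0 ≤ a) (hb : 0 ≤ b) (n : ℕ)
    (hmat : CuntzLE
      (Matrix.diagonal (fun _ : Fin (n + 1) => a))
      (Matrix.diagonal (fun i : Fin (n + 1) => if (i : ℕ) < n then b else 0))) :
    CuntzLE a b := by
  classical
  obtain ⟨P, Q, hPQ⟩ := hmat
  have hent : ∀ i j, Tendsto (fun m => (P m * Matrix.diagonal
      (fun i : Fin (n + 1) => if (i : ℕ) < n then b else 0) * Q m) i j) atTop
      (𝓝 (Matrix.diagonal (fun _ : Fin (n + 1) => a) i j)) := fun i j =>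
    (tendsto_pi_nhds.1 (tendsto_pi_nhds.1 hPQ i) j)
  by_cases hb0 : b = 0
  · have h0 := hent 0 0
    have ha0 : a = 0 := by
      subst hb0
      simp only [ite_self, Matrix.diagonal_zero, mul_zero, zero_mul, Matrix.zero_apply,
        Matrix.diagonal_apply_eq] at h0
      exact tendsto_nhds_unique h0 tendsto_const_nhds
    exact ⟨fun _ => 0, fun _ => 0, by simp [ha0]⟩
  obtain ⟨κ, _, z, w, hzw⟩ := aux_simple hsimple b hb0
  suffices hmain : ∀ ε : ℝ, 0 < ε → ∃ U V : A, ‖U * b * V - a‖ < 3 * ε by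
    choose U V hUV using fun m : ℕ => hmain (1 / ((m : ℝ) + 1)) (by positivity)
    refine ⟨U, V, ?_⟩
    rw [tendsto_iff_norm_sub_tendsto_zero]
    have h3 : Tendsto (fun m : ℕ => 3 * (1 / ((m : ℝ) + 1))) atTop (𝓝 0) := by
      simpa using tendsto_one_div_add_atTop_nhds_zero_nat.const_mul (3 : ℝ)
    exact squeeze_zero (fun _ => norm_nonneg _) (fun m => (hUV m).le) h3
  intro ε hε
  have hc : 0 < ε / (2 * ((n : ℝ) + 1)) := by positivity
  have hev : ∀ᶠ m in atTop, ∀ i j, dist ((P m * Matrix.diagonal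
      (fun i : Fin (n + 1) => if (i : ℕ) < n then b else 0) * Q m) i j)
      (Matrix.diagonal (fun _ : Fin (n + 1) => a) i j) < ε / (2 * ((n : ℝ) + 1)) := by
    rw [eventually_all]; intro i
    rw [eventually_all]; intro j
    exact (Metric.tendsto_nhds.1 (hent i j)) _ hc
  obtain ⟨m, hm⟩ := hev.exists
  obtain ⟨r₀, hr₀⟩ := aux_nonneg_exists ha
  obtain ⟨d₀, hd₀⟩ := aux_nonneg_exists hb
  obtain ⟨ρ, hρ, H⟩ := aux_perturb a b r₀ hr₀.symm n (fun i j => P m i j) (fun i j => Q m i j) hε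
    (fun i j => by
      have := hm i j
      rw [dist_comm, dist_eq_norm] at this
      exact this) z w hzw
  have hcd : Continuous fun d : A => star d * d := by fun_prop
  obtain ⟨ρ', hρ', H'⟩ := Metric.continuous_iff.1 hcd d₀ (ρ / 3) (by positivity)
  obtain ⟨C, hC, hF, hcomp⟩ := happrox
    ((Finset.univ.image fun p : Fin (n + 1) × Fin (n + 1) => P m p.1 p.2) ∪
      (Finset.univ.image fun p : Fin (n + 1) × Fin (n + 1) => Q m p.1 p.2) ∪
      Finset.univ.image z ∪ Finset.univ.image w ∪ {r₀, d₀})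
    (min (ρ / 2) (ρ' / 2)) (1 / (2 * (Fintype.card κ + 1) * (n + 1)))
    (by positivity) (by positivity)
  have hF2 : ∀ f ∈ _, ∃ c : C, dist (c : A) f < ρ ∧ dist (c : A) f < ρ' := fun f hf => by
    obtain ⟨c, hcC, hc⟩ := hF f hf
    refine ⟨⟨c, hcC⟩, ?_⟩
    rw [dist_comm, dist_eq_norm]
    have h1 := min_le_left (ρ / 2) (ρ' / 2)
    have h2 := min_le_right (ρ / 2) (ρ' / 2)
    constructor <;> linarith
  choose X hX _ using fun i j => hF2 (P m i j) (by
    simp only [Finset.mem_union]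
    exact Or.inl (Or.inl (Or.inl (Or.inl (Finset.mem_image.2 ⟨(i, j), Finset.mem_univ _, rfl⟩)))))
  choose Y hY _ using fun i j => hF2 (Q m i j) (by
    simp only [Finset.mem_union]
    exact Or.inl (Or.inl (Or.inl (Or.inr (Finset.mem_image.2 ⟨(i, j), Finset.mem_univ _, rfl⟩)))))
  choose z' hz _ using fun i => hF2 (z i) (by
    simp only [Finset.mem_union]
    exact Or.inl (Or.inl (Or.inr (Finset.mem_image.2 ⟨i, Finset.mem_univ _, rfl⟩))))
  choose w' hw _ using fun i => hF2 (w i) (by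
    simp only [Finset.mem_union]
    exact Or.inl (Or.inr (Finset.mem_image.2 ⟨i, Finset.mem_univ _, rfl⟩)))
  obtain ⟨r, hr, -⟩ := hF2 r₀ (by simp)
  obtain ⟨d, -, hd⟩ := hF2 d₀ (by simp)
  have : IsClosed (C : Set A) := hC
  let _ : PartialOrder C := CStarAlgebra.spectralOrder C
  have : StarOrderedRing C := CStarAlgebra.spectralOrderedRing C
  have hrange : Set.range (C.subtype : C →⋆ₐ[ℂ] A) = (C : Set A) := Subtype.range_coe
  refine aux_core (C.subtype : C →⋆ₐ[ℂ] A) isometry_subtype_coe n (κ := κ) ?_ a b r d X Y z' w'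
    hε hρ ?_ ?_
  · intro x y hx hy hτ
    rw [hrange] at hτ ⊢
    exact hcomp x x.2 y y.2 hx hy hτ
  · have := H' d hd
    rw [dist_eq_norm, ← hd₀] at this
    exact this
  · intro y hy
    exact H _ _ _ _ y r hX hY hz hw hy hr
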